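/- For the complete 3-partite graph K_{r,r,r} with all three parts of size r, τ_3(K_{r,r,r}) = ⌊(3r − 3)/2⌋. -/

import Mathlib

open SimpleGraph Finset

variable {V : Type*}

/-- A pedant `S`-Steiner tree in `G`: a subtree of `G` containing `S` in which
every vertex of `S` has degree one. -/
def IsPedantTree [Fintype V] (G : SimpleGraph V) (S : Finset V) (T : G.Subgraph) : Prop :=
  T.coe.IsTree ∧ (↑S : Set V) ⊆ T.verts ∧ ∀ v ∈ S, (T.neighborSet v).ncard = 1

/-- Two pedant `S`-Steiner trees are internally disjoint if they are edge-disjoint and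
their vertex sets intersect exactly in `S`. -/
def InternallyDisjoint [Fintype V] (G : SimpleGraph V) (S : Finset V)
    (T T' : G.Subgraph) : Prop :=
  T.edgeSet ∩ T'.edgeSet = ∅ ∧ T.verts ∩ T'.verts = (↑S : Set V)

/-- The local pedant-tree connectivity `τ_G(S)`: the maximum number of pairwise
internally disjoint pedant `S`-Steiner trees in `G`. -/
noncomputable def localPedantConn [Fintype V] (G : SimpleGraph V) (S : Finset V) : ℕ :=
  sSup {m | ∃ 𝒯 : Finset G.Subgraph, 𝒯.card = m ∧ (∀ T ∈ 𝒯, IsPedantTree G S T) ∧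
    ∀ T ∈ 𝒯, ∀ T' ∈ 𝒯, T ≠ T' → InternallyDisjoint G S T T'}

/-- The pedant tree-connectivity `τ_k(G) = min {τ_G(S) : |S| = k}`. -/
noncomputable def pedantConn [Fintype V] (G : SimpleGraph V) (k : ℕ) : ℕ :=
  sInf {m | ∃ S : Finset V, S.card = k ∧ localPedantConn G S = m}

/-- The vertex connectivity of `G`: the least size of a vertex set whose removal leaves a
graph which is not preconnected, or leaves at most one vertex. -/
noncomputable def vConn [Fintype V] (G : SimpleGraph V) : ℕ :=
  sInf {m | ∃ U : Finset V, U.card = m ∧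
    (¬ (G.induce ((↑U : Set V)ᶜ)).Preconnected ∨ Fintype.card V ≤ m + 1)}


/-- A finite graph whose edges all join a vertex to its parent, every grandparent being the
root, is a tree. -/
theorem isTree_of_parent [Finite V] {G : SimpleGraph V} (root : V) (p : V → V)
    (hp : ∀ x, x ≠ root → G.Adj x (p x)) (hpp : ∀ x, p (p x) = root)
    (hG : ∀ x y, G.Adj x y → x ≠ root ∧ y = p x ∨ y ≠ root ∧ x = p y) : G.IsTree := by
  classical
  have hreach : ∀ x, G.Reachable x root := by
    have hstep : ∀ x, G.Reachable (p x) root → G.Reachable x root := fun x h ↦ by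
      by_cases hx : x = root
      · exact hx ▸ Reachable.refl x
      · exact (hp x hx).reachable.trans h
    exact fun x ↦ hstep x (hstep _ (by rw [hpp]))
  have hconn : G.Connected :=
    { preconnected := fun x y ↦ (hreach x).trans (hreach y).symm
      nonempty := ⟨root⟩ }
  refine isTree_iff_connected_and_card.2 ⟨hconn,
    le_antisymm ?_ hconn.card_vert_le_card_edgeSet_add_one⟩
  have hsurj : Function.Surjective
      (fun x : {x // x ≠ root} ↦ (⟨s(x.1, p x.1), hp x.1 x.2⟩ : G.edgeSet)) := by
    rintro ⟨e, he⟩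
    induction e with
    | _ x y =>
      rcases hG x y he with ⟨hx, rfl⟩ | ⟨hy, rfl⟩
      · exact ⟨⟨x, hx⟩, rfl⟩
      · exact ⟨⟨y, hy⟩, Subtype.ext Sym2.eq_swap⟩
  have hle : Nat.card G.edgeSet ≤ _ := Nat.card_le_card_of_surjective _ hsurj
  have := Fintype.ofFinite V
  have hcard : Nat.card {x // x ≠ root} + 1 = Nat.card V := by
    have : 0 < Fintype.card V := Fintype.card_pos_iff.2 ⟨root⟩
    simp only [Nat.card_eq_fintype_card, Fintype.card_subtype_compl, Fintype.card_subtype_eq]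
    omega
  omega

/-- Two vertices `u`, `v` outside `S` which are equal or adjacent and jointly dominate `S` span,
together with `S`, a pedant `S`-Steiner tree without edges inside `S`. -/
theorem exists_isPedantTree [Fintype V] {G : SimpleGraph V} {S : Finset V} {u v : V}
    (hu : u ∉ S) (hv : v ∉ S) (huv : u = v ∨ G.Adj u v)
    (hS : ∀ s ∈ S, G.Adj s u ∨ G.Adj s v) :
    ∃ T : G.Subgraph, IsPedantTree G S T ∧ T.verts = ↑S ∪ {u, v} ∧
      ∀ x y, T.Adj x y → x ∈ S → y ∉ S := by
  classical
  let p : V → V := fun x ↦ if x ∈ S ∧ ¬ G.Adj x u then v else u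
  have hpS : ∀ x, p x = u ∨ p x = v := fun x ↦ by by_cases h : x ∈ S ∧ ¬ G.Adj x u <;> simp [p, h]
  have hpnS : ∀ x, p x ∉ S := fun x ↦ by rcases hpS x with h | h <;> rwa [h]
  have hp0 : ∀ x, x ∉ S → p x = u := fun x hx ↦ by simp [p, hx]
  have hadj : ∀ x, (x ∈ S ∨ x = v) → x ≠ u → G.Adj x (p x) := by
    intro x hx hxu
    by_cases hxS : x ∈ S
    · by_cases h : G.Adj x u
      · simp [p, h]
      · simpa [p, h, hxS] using hS x hxS
    · rw [hp0 x hxS]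
      obtain rfl : x = v := hx.resolve_left hxS
      exact (huv.resolve_left (Ne.symm hxu)).symm
  let T : G.Subgraph :=
    { verts := ↑S ∪ {u, v}
      Adj := fun x y ↦ ((x ∈ S ∨ x = v) ∧ x ≠ u ∧ y = p x) ∨ ((y ∈ S ∨ y = v) ∧ y ≠ u ∧ x = p y)
      adj_sub := by
        rintro x y (⟨h1, h2, rfl⟩ | ⟨h1, h2, rfl⟩)
        · exact hadj _ h1 h2
        · exact (hadj _ h1 h2).symm
      edge_vert := by
        rintro x y (⟨h1 | h1, h2, rfl⟩ | ⟨h1, h2, rfl⟩)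
        · simp [h1]
        · simp [h1]
        · rcases hpS y with h | h <;> simp [h]
      symm := ⟨fun x y h ↦ h.symm⟩ }
  have hT : ∀ x y, T.Adj x y ↔
      ((x ∈ S ∨ x = v) ∧ x ≠ u ∧ y = p x) ∨ ((y ∈ S ∨ y = v) ∧ y ≠ u ∧ x = p y) :=
    fun _ _ ↦ Iff.rfl
  have hne : ∀ x ∈ S, x ≠ u := fun x hx h ↦ hu (h ▸ hx)
  have hadjS : ∀ x ∈ S, ∀ y, T.Adj x y ↔ y = p x := by
    intro x hx y
    rw [hT]
    constructor
    · rintro (h | h)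
      · exact h.2.2
      · exact absurd (h.2.2 ▸ hx) (hpnS y)
    · exact fun h ↦ Or.inl ⟨Or.inl hx, hne x hx, h⟩
  refine ⟨T, ⟨?_, Set.subset_union_left, fun x hx ↦ ?_⟩, rfl, fun x y h hx ↦ ?_⟩
  · have hpT : ∀ x, p x ∈ T.verts := fun x ↦ by rcases hpS x with h | h <;> simp [h, T]
    refine isTree_of_parent (⟨u, by simp [T]⟩ : T.verts) (fun x ↦ ⟨p x, hpT x⟩) ?_ ?_ ?_
    · rintro ⟨x, hx⟩ hxu
      have hxu' : x ≠ u := fun h ↦ hxu (Subtype.ext h)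
      have hx' : x ∈ S ∨ x = v := by simpa [T, hxu', or_comm] using hx
      exact Or.inl ⟨hx', hxu', rfl⟩
    · exact fun x ↦ Subtype.ext (hp0 _ (hpnS _))
    · rintro ⟨x, hx⟩ ⟨y, hy⟩ (⟨-, h2, h3⟩ | ⟨-, h2, h3⟩)
      · exact Or.inl ⟨fun h ↦ h2 (congrArg Subtype.val h), Subtype.ext h3⟩
      · exact Or.inr ⟨fun h ↦ h2 (congrArg Subtype.val h), Subtype.ext h3⟩
  · rw [Set.ncard_eq_one]
    exact ⟨p x, Set.ext fun y ↦ hadjS x hx y⟩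
  · rw [(hadjS x hx y).1 h]
    exact hpnS x

/-- The family sizes whose supremum is `localPedantConn` are bounded. -/
theorem bddAbove_internallyDisjoint_card [Fintype V] (G : SimpleGraph V) (S : Finset V) :
    BddAbove {m | ∃ 𝒯 : Finset G.Subgraph, 𝒯.card = m ∧ (∀ T ∈ 𝒯, IsPedantTree G S T) ∧
      ∀ T ∈ 𝒯, ∀ T' ∈ 𝒯, T ≠ T' → InternallyDisjoint G S T T'} := by
  classical
  have := Fintype.ofFinite G.Subgraph
  refine ⟨Fintype.card G.Subgraph, ?_⟩
  rintro _ ⟨𝒯, rfl, -⟩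
  exact Finset.card_le_univ 𝒯

/-- A family of disjoint dominating vertices and edges outside `S` bounds `localPedantConn` from
below. -/
theorem card_le_localPedantConn [Fintype V] {G : SimpleGraph V} {S : Finset V}
    {ι : Type*} [Fintype ι] (u v : ι → V) (hu : ∀ i, u i ∉ S) (hv : ∀ i, v i ∉ S)
    (huv : ∀ i, u i = v i ∨ G.Adj (u i) (v i))
    (hS : ∀ i, ∀ s ∈ S, G.Adj s (u i) ∨ G.Adj s (v i))
    (huu : Function.Injective u) (hvv : Function.Injective v)
    (hne : ∀ i j, i ≠ j → u i ≠ v j) :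
    Fintype.card ι ≤ localPedantConn G S := by
  classical
  choose T hT hverts hedge using fun i ↦ exists_isPedantTree (hu i) (hv i) (huv i) (hS i)
  have hinter : ∀ i j, i ≠ j → (T i).verts ∩ (T j).verts = (↑S : Set V) := by
    intro i j hij
    rw [hverts, hverts, ← Set.union_inter_distrib_left, Set.union_eq_left]
    have h1 := huu.ne hij
    have h2 := hvv.ne hij
    have h3 := hne i j hij
    have h4 := hne j i hij.symm
    rintro x ⟨hx, hx'⟩
    simp only [Set.mem_insert_iff, Set.mem_singleton_iff] at hx hx'
    grind
  have hinj : Function.Injective T := by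
    intro i j hij
    by_contra hne'
    have hmem : u i ∈ (T i).verts ∩ (T j).verts := by
      rw [← hij, Set.inter_self, hverts]
      simp
    rw [hinter i j hne'] at hmem
    exact hu i hmem
  refine le_csSup (bddAbove_internallyDisjoint_card G S)
    ⟨univ.map ⟨T, hinj⟩, by simp, by simpa using hT, ?_⟩
  simp only [Finset.mem_map, Finset.mem_univ, true_and, Function.Embedding.coeFn_mk]
  rintro _ ⟨i, rfl⟩ _ ⟨j, rfl⟩ hij
  have hij' : i ≠ j := fun h ↦ hij (h ▸ rfl)
  refine ⟨?_, hinter i j hij'⟩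
  rw [Set.eq_empty_iff_forall_notMem]
  rintro e ⟨he, he'⟩
  induction e with
  | _ x y =>
    rw [Subgraph.mem_edgeSet] at he he'
    have hx : x ∈ (↑S : Set V) := hinter i j hij' ▸ ⟨he.fst_mem, he'.fst_mem⟩
    have hy : y ∈ (↑S : Set V) := hinter i j hij' ▸ ⟨he.snd_mem, he'.snd_mem⟩
    exact hedge i x y he hx hy

/-- In a pedant tree for at least three terminals, no two terminals are adjacent. -/
theorem IsPedantTree.notMem_of_adj [Fintype V] {G : SimpleGraph V} {S : Finset V}
    {T : G.Subgraph} (hT : IsPedantTree G S T) (hS : 3 ≤ S.card) {x y : V} (hx : x ∈ S)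
    (hxy : T.Adj x y) : y ∉ S := by
  classical
  intro hy
  obtain ⟨htree, hsub, hdeg⟩ := hT
  have huniq : ∀ a ∈ S, ∀ b c, T.Adj a b → T.Adj a c → b = c := by
    intro a ha b c hb hc
    obtain ⟨d, hd⟩ := Set.ncard_eq_one.1 (hdeg a ha)
    have hb' : b ∈ T.neighborSet a := hb
    have hc' : c ∈ T.neighborSet a := hc
    rw [hd] at hb' hc'
    exact hb'.trans hc'.symm
  obtain ⟨z, hz, hzxy⟩ : ∃ z ∈ S, z ∉ ({x, y} : Finset V) :=
    Finset.exists_mem_notMem_of_card_lt_card (Finset.card_le_two.trans_lt hS)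
  obtain ⟨w⟩ := htree.connected.preconnected ⟨x, hsub hx⟩ ⟨z, hsub hz⟩
  have hwalk : ∀ (a b : T.verts), T.coe.Walk a b →
      a.1 ∈ ({x, y} : Finset V) → b.1 ∈ ({x, y} : Finset V) := by
    intro a b w
    induction w with
    | nil => exact id
    | @cons a c b h _ ih =>
      intro ha
      apply ih
      have h' : T.Adj a c := h
      simp only [Finset.mem_insert, Finset.mem_singleton] at ha ⊢
      rcases ha with ha | ha
      · exact Or.inr (huniq x hx _ _ (ha ▸ h') hxy)
      · exact Or.inl (huniq y hy _ _ (ha ▸ h') hxy.symm)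
  exact hzxy (hwalk _ _ w (by simp))

/-- If no vertex is adjacent to all of the at least three terminals, then every tree of an
internally disjoint family uses two vertices outside `S`. -/
theorem two_mul_localPedantConn_add_card_le [Fintype V] {G : SimpleGraph V} {S : Finset V}
    (hS : 3 ≤ S.card) (hdom : ∀ w, ∃ s ∈ S, ¬ G.Adj s w) :
    2 * localPedantConn G S + S.card ≤ Fintype.card V := by
  classical
  obtain ⟨𝒯, hcard, htree, hdisj⟩ := Nat.sSup_mem
    ⟨0, by exact ⟨∅, by simp⟩⟩ (bddAbove_internallyDisjoint_card G S)
  change #𝒯 = localPedantConn G S at hcard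
  rw [← hcard, ← Finset.card_compl_add_card S, Nat.add_le_add_iff_right]
  have hpair : (𝒯 : Set G.Subgraph).PairwiseDisjoint fun T ↦ T.verts.toFinset \ S := by
    intro T hT T' hT' hne
    rw [Function.onFun, Finset.disjoint_left]
    intro x hx hx'
    simp only [Finset.mem_sdiff, Set.mem_toFinset] at hx hx'
    have : x ∈ (↑S : Set V) := (hdisj T hT T' hT' hne).2 ▸ ⟨hx.1, hx'.1⟩
    exact hx.2 this
  calc 2 * #𝒯 = ∑ T ∈ 𝒯, 2 := by simp [mul_comm]
    _ ≤ ∑ T ∈ 𝒯, #(T.verts.toFinset \ S) := by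
      refine Finset.sum_le_sum fun T hT ↦ ?_
      have hn : ∀ s ∈ S, ∃ w, T.Adj s w := fun s hs ↦ by
        obtain ⟨w, hw⟩ := Set.ncard_eq_one.1 ((htree T hT).2.2 s hs)
        exact ⟨w, (hw ▸ rfl : w ∈ T.neighborSet s)⟩
      have hmem : ∀ s ∈ S, ∀ w, T.Adj s w → w ∈ T.verts.toFinset \ S := fun s hs w hw ↦ by
        simpa using ⟨hw.snd_mem, (htree T hT).notMem_of_adj hS hs hw⟩
      obtain ⟨s, hs⟩ : S.Nonempty := Finset.card_pos.1 (by omega)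
      obtain ⟨w, hw⟩ := hn s hs
      obtain ⟨t, ht, htw⟩ := hdom w
      obtain ⟨w', hw'⟩ := hn t ht
      exact Finset.one_lt_card.2 ⟨w, hmem s hs w hw, w', hmem t ht w' hw',
        fun h ↦ htw (h ▸ hw'.adj_sub)⟩
    _ = #(𝒯.biUnion fun T ↦ T.verts.toFinset \ S) := (Finset.card_biUnion hpair).symm
    _ ≤ #Sᶜ := by
      refine Finset.card_le_card fun x hx ↦ ?_
      simp only [Finset.mem_biUnion, Finset.mem_sdiff] at hx
      obtain ⟨_, _, _, hx⟩ := hx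
      simpa using hx

/-- Vertices of one part avoiding `S`, enumerated. -/
theorem exists_injective_notMem {α : Type*} [DecidableEq α] {r : ℕ}
    (S : Finset (Σ _ : α, Fin r)) (i : α) {n : ℕ} (hn : n + #{x ∈ S | x.1 = i} ≤ r) :
    ∃ e : Fin n → Fin r, Function.Injective e ∧ ∀ t, (⟨i, e t⟩ : Σ _ : α, Fin r) ∉ S := by
  classical
  let B : Finset (Fin r) := {t | (⟨i, t⟩ : Σ _ : α, Fin r) ∉ S}
  have hB : #Bᶜ ≤ #{x ∈ S | x.1 = i} :=
    Finset.card_le_card_of_injOn (fun t ↦ ⟨i, t⟩) (fun t ht ↦ by simpa [B] using ht)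
      (fun t _ t' _ h ↦ by simpa using h)
  have hnB : n ≤ #B := by
    have := Finset.card_compl_add_card B
    rw [Fintype.card_fin] at this
    omega
  refine ⟨fun t ↦ B.orderEmbOfFin rfl (Fin.castLE hnB t), fun t t' h ↦ ?_, fun t ↦ ?_⟩
  · simpa using h
  · exact (Finset.mem_filter.1 (B.orderEmbOfFin_mem rfl (Fin.castLE hnB t))).2

/-- The ways to distribute three elements over three classes. -/
theorem cases_of_sum_eq_three {c : Fin 3 → ℕ} (hsum : c 0 + c 1 + c 2 = 3) :
    (∀ i, c i = 1) ∨ (∃ i j, i ≠ j ∧ c i = 0 ∧ c j = 0) ∨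
      ∃ i j l, i ≠ j ∧ i ≠ l ∧ j ≠ l ∧ c i = 2 ∧ c j = 1 ∧ c l = 0 := by
  have : (c 0 = 1 ∧ c 1 = 1 ∧ c 2 = 1) ∨ (c 0 = 0 ∧ c 1 = 0) ∨ (c 0 = 0 ∧ c 2 = 0) ∨
    (c 1 = 0 ∧ c 2 = 0) ∨ (c 0 = 2 ∧ c 1 = 1 ∧ c 2 = 0) ∨ (c 0 = 2 ∧ c 2 = 1 ∧ c 1 = 0) ∨
    (c 1 = 2 ∧ c 0 = 1 ∧ c 2 = 0) ∨ (c 1 = 2 ∧ c 2 = 1 ∧ c 0 = 0) ∨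
    (c 2 = 2 ∧ c 0 = 1 ∧ c 1 = 0) ∨ (c 2 = 2 ∧ c 1 = 1 ∧ c 0 = 0) := by
    generalize c 0 = x, c 1 = y, c 2 = z at hsum ⊢
    have hx : x ≤ 3 := by omega
    have hy : y ≤ 3 := by omega
    interval_cases x <;> interval_cases y <;> omega
  rcases this with h | h | h | h | h | h | h | h | h | h
  · left; intro i; fin_cases i <;> simp [h]
  · exact Or.inr (Or.inl ⟨0, 1, by decide, h⟩)
  · exact Or.inr (Or.inl ⟨0, 2, by decide, h⟩)
  · exact Or.inr (Or.inl ⟨1, 2, by decide, h⟩)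
  · exact Or.inr (Or.inr ⟨0, 1, 2, by decide, by decide, by decide, h⟩)
  · exact Or.inr (Or.inr ⟨0, 2, 1, by decide, by decide, by decide, h⟩)
  · exact Or.inr (Or.inr ⟨1, 0, 2, by decide, by decide, by decide, h⟩)
  · exact Or.inr (Or.inr ⟨1, 2, 0, by decide, by decide, by decide, h⟩)
  · exact Or.inr (Or.inr ⟨2, 0, 1, by decide, by decide, by decide, h⟩)
  · exact Or.inr (Or.inr ⟨2, 1, 0, by decide, by decide, by decide, h⟩)

/-- The lower bound: enough disjoint trees for every choice of three vertices. -/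
theorem le_localPedantConn_K_rrr {r : ℕ} (S : Finset (Σ _ : Fin 3, Fin r)) (hS : #S = 3) :
    (3 * r - 3) / 2 ≤ localPedantConn (completeMultipartiteGraph (fun _ : Fin 3 => Fin r)) S := by
  classical
  let c : Fin 3 → ℕ := fun i ↦ #{x ∈ S | x.1 = i}
  have hsum : c 0 + c 1 + c 2 = 3 := by
    rw [← Fin.sum_univ_three c]
    exact (Finset.card_eq_sum_card_fiberwise (by simp)).symm.trans hS
  have hzero : ∀ i, c i = 0 → ∀ s ∈ S, s.1 ≠ i := by
    intro i hi s hs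
    exact Finset.filter_eq_empty_iff.1 (Finset.card_eq_zero.1 hi) hs
  have hcases := cases_of_sum_eq_three hsum
  rcases Nat.lt_or_ge r 2 with hr | hr
  · have : (3 * r - 3) / 2 = 0 := by omega
    omega
  rcases hcases with hc | ⟨i, j, hij, hi, hj⟩ | ⟨i, j, l, hij, hil, hjl, hi, hj, hl⟩
  · choose e he heS using fun i ↦ exists_injective_notMem S i (n := r - 1)
      (show r - 1 + c i ≤ r by rw [hc i]; omega)
    have hpos : 0 < r - 1 := by omega
    let f : Fin (3 * (r - 1)) → Σ _ : Fin 3, Fin r :=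
      fun t ↦ ⟨t.divNat, e t.divNat t.modNat⟩
    have hf : Function.Injective f := by
      intro t t' h
      have h1 : t.divNat = t'.divNat := congrArg Sigma.fst h
      have h2 : e t.divNat t.modNat = e t'.divNat t'.modNat := by simpa [f, h1] using h
      rw [← h1] at h2
      exact finProdFinEquiv.symm.injective (Prod.ext h1 (he _ h2))
    let a : Fin ((3 * r - 3) / 2) → Fin (3 * (r - 1)) := fun t ↦ ⟨t, by omega⟩
    let b : Fin ((3 * r - 3) / 2) → Fin (3 * (r - 1)) := fun t ↦ ⟨t + (3 * r - 3) / 2, by omega⟩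
    have hab : ∀ t, (f (a t)).1 ≠ (f (b t)).1 := by
      intro t h
      have h' : (t : ℕ) / (r - 1) = (t + (3 * r - 3) / 2) / (r - 1) := congrArg Fin.val h
      have h1 : (t + (r - 1)) / (r - 1) ≤ (t + (3 * r - 3) / 2) / (r - 1) :=
        Nat.div_le_div_right (by omega)
      rw [Nat.add_div_right _ hpos] at h1
      omega
    have key := card_le_localPedantConn (G := completeMultipartiteGraph (fun _ : Fin 3 => Fin r))
      (S := S) (f ∘ a) (f ∘ b) (fun t ↦ heS _ _) (fun t ↦ heS _ _) (fun t ↦ Or.inr (hab t))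
      (fun t s _ ↦ by
        have := hab t
        change s.1 ≠ (f (a t)).1 ∨ s.1 ≠ (f (b t)).1
        grind)
      (hf.comp fun t t' h ↦ Fin.ext (by simpa [a] using h))
      (hf.comp fun t t' h ↦ Fin.ext (by simpa [b] using h))
      (fun t t' _ h ↦ by
        have : (t : ℕ) = t' + (3 * r - 3) / 2 := congrArg Fin.val (hf h)
        omega)
    simpa using key
  · let u : Fin r ⊕ Fin r → Σ _ : Fin 3, Fin r := Sum.elim (fun t ↦ ⟨i, t⟩) (fun t ↦ ⟨j, t⟩)
    have hu : ∀ t, ∀ s ∈ S, s.1 ≠ (u t).1 := by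
      rintro (t | t)
      · exact hzero i hi
      · exact hzero j hj
    have huS : ∀ t, u t ∉ S := fun t h ↦ hu t _ h rfl
    have hinj : Function.Injective u := by
      rintro (t | t) (t' | t') h <;> simp_all [u]
    have key := card_le_localPedantConn (G := completeMultipartiteGraph (fun _ : Fin 3 => Fin r))
      (S := S) u u huS huS (fun _ ↦ Or.inl rfl) (fun t s hs ↦ Or.inl (hu t s hs)) hinj hinj
      (fun _ _ h ↦ hinj.ne h)
    simp only [Fintype.card_sum, Fintype.card_fin] at key
    omega
  · obtain ⟨e, he, heS⟩ := exists_injective_notMem S i (n := r - 2)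
      (show r - 2 + c i ≤ r by omega)
    obtain ⟨e', he', heS'⟩ := exists_injective_notMem S j (n := r - 2)
      (show r - 2 + c j ≤ r by omega)
    have hlS : ∀ t, (⟨l, t⟩ : Σ _ : Fin 3, Fin r) ∉ S := fun t h ↦ hzero l hl _ h rfl
    let u : Fin r ⊕ Fin (r - 2) → Σ _ : Fin 3, Fin r :=
      Sum.elim (fun t ↦ ⟨l, t⟩) (fun t ↦ ⟨i, e t⟩)
    let v : Fin r ⊕ Fin (r - 2) → Σ _ : Fin 3, Fin r :=
      Sum.elim (fun t ↦ ⟨l, t⟩) (fun t ↦ ⟨j, e' t⟩)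
    have key := card_le_localPedantConn (G := completeMultipartiteGraph (fun _ : Fin 3 => Fin r))
      (S := S) u v
      (by rintro (t | t); exacts [hlS t, heS t])
      (by rintro (t | t); exacts [hlS t, heS' t])
      (by rintro (t | t); exacts [Or.inl rfl, Or.inr hij])
      (by
        rintro (t | t) s hs
        · exact Or.inl (hzero l hl s hs)
        · change s.1 ≠ i ∨ s.1 ≠ j
          grind)
      (by rintro (t | t) (t' | t') h <;> simp_all [u, he.eq_iff])
      (by rintro (t | t) (t' | t') h <;> simp_all [v, he'.eq_iff])
      (by rintro (t | t) (t' | t') h h' <;> simp_all [u, v])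
    simp only [Fintype.card_sum, Fintype.card_fin] at key
    omega

/-- `τ_3(K_{r,r,r}) = ⌊(3r − 3)/2⌋`. -/
theorem pedantConn_K_rrr (r : ℕ) (hr : 1 ≤ r) :
    pedantConn (completeMultipartiteGraph (fun _ : Fin 3 => Fin r)) 3 =
      (3 * r - 3) / 2 := by
  classical
  let s : Fin 3 ↪ Σ _ : Fin 3, Fin r := ⟨fun i ↦ ⟨i, ⟨0, hr⟩⟩, fun _ _ h ↦ congrArg Sigma.fst h⟩
  have hcard : #(univ.map s) = 3 := by simp
  apply le_antisymm
  · refine le_trans (b := localPedantConn _ (univ.map s))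
      (Nat.sInf_le ⟨univ.map s, hcard, rfl⟩) ?_
    have h := two_mul_localPedantConn_add_card_le
      (G := completeMultipartiteGraph (fun _ : Fin 3 => Fin r)) hcard.ge
      (fun w ↦ ⟨s w.1, by simp, fun h ↦ h rfl⟩)
    rw [hcard] at h
    simp only [Fintype.card_sigma, Fintype.card_fin, Finset.sum_const, Finset.card_univ,
      smul_eq_mul] at h
    omega
  · unfold pedantConn
    refine le_csInf ⟨_, univ.map s, hcard, rfl⟩ ?_
    rintro _ ⟨S, hS, rfl⟩
    exact le_localPedantConn_K_rrr S hS
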